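/- An element u ∈ U = Diff(𝒜) commutes with both x and y if and only if u belongs to the subalgebra S of U generated by x and y; that is, the centralizer of {x, y} in U equals S. -/

import Mathlib

/-!
Let `k` be a field of characteristic zero, `t ∈ k`, `t ≠ 0`, and let `U = Diff 𝒜` be the
algebra presented by generators `x, y, D, E` and relations `[y,x] = 0`, `[D,x] = 0`,
`[D,y] = y² + txy`, `[E,x] = x`, `[E,y] = y`, `[E,D] = D`.  An element `u ∈ U` commutes
with both `x` and `y` iff it lies in the subalgebra `S` generated by `x` and `y`.
-/

/-- Relations presenting `Diff 𝒜`; the generators are `x = ι 0`, `y = ι 1`, `D = ι 2`,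
`E = ι 3`. -/
inductive DiffRel (k : Type) [Field k] (t : k) :
    FreeAlgebra k (Fin 4) → FreeAlgebra k (Fin 4) → Prop
  | yx : DiffRel k t (FreeAlgebra.ι k 1 * FreeAlgebra.ι k 0)
      (FreeAlgebra.ι k 0 * FreeAlgebra.ι k 1)
  | Dx : DiffRel k t (FreeAlgebra.ι k 2 * FreeAlgebra.ι k 0)
      (FreeAlgebra.ι k 0 * FreeAlgebra.ι k 2)
  | Dy : DiffRel k t (FreeAlgebra.ι k 2 * FreeAlgebra.ι k 1)
      (FreeAlgebra.ι k 1 * FreeAlgebra.ι k 2 +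
        (FreeAlgebra.ι k 1 * FreeAlgebra.ι k 1 + t • (FreeAlgebra.ι k 0 * FreeAlgebra.ι k 1)))
  | Ex : DiffRel k t (FreeAlgebra.ι k 3 * FreeAlgebra.ι k 0)
      (FreeAlgebra.ι k 0 * FreeAlgebra.ι k 3 + FreeAlgebra.ι k 0)
  | Ey : DiffRel k t (FreeAlgebra.ι k 3 * FreeAlgebra.ι k 1)
      (FreeAlgebra.ι k 1 * FreeAlgebra.ι k 3 + FreeAlgebra.ι k 1)
  | ED : DiffRel k t (FreeAlgebra.ι k 3 * FreeAlgebra.ι k 2)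
      (FreeAlgebra.ι k 2 * FreeAlgebra.ι k 3 + FreeAlgebra.ι k 2)

/-- The algebra `Diff 𝒜` of differential operators tangent to a central arrangement of
three lines. -/
abbrev DiffA (k : Type) [Field k] (t : k) : Type := RingQuot (DiffRel k t)

variable (k : Type) [Field k] (t : k)

/-- The generator `x` of `Diff 𝒜`. -/
noncomputable def genX : DiffA k t := RingQuot.mkAlgHom k (DiffRel k t) (FreeAlgebra.ι k 0)

/-- The generator `y` of `Diff 𝒜`. -/
noncomputable def genY : DiffA k t := RingQuot.mkAlgHom k (DiffRel k t) (FreeAlgebra.ι k 1)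

namespace DiffAux

open MvPolynomial

noncomputable def genD : DiffA k t := RingQuot.mkAlgHom k (DiffRel k t) (FreeAlgebra.ι k 2)
noncomputable def genE : DiffA k t := RingQuot.mkAlgHom k (DiffRel k t) (FreeAlgebra.ι k 3)

theorem yx : genY k t * genX k t = genX k t * genY k t := by
  simpa [genX, genY] using RingQuot.mkAlgHom_rel k (DiffRel.yx (k := k) (t := t))
theorem Dx : genD k t * genX k t = genX k t * genD k t := by
  simpa [genX, genD] using RingQuot.mkAlgHom_rel k (DiffRel.Dx (k := k) (t := t))
theorem Dy : genD k t * genY k t = genY k t * genD k t +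
    (genY k t * genY k t + t • (genX k t * genY k t)) := by
  simpa [genX, genY, genD] using RingQuot.mkAlgHom_rel k (DiffRel.Dy (k := k) (t := t))
theorem Ex : genE k t * genX k t = genX k t * genE k t + genX k t := by
  simpa [genX, genE] using RingQuot.mkAlgHom_rel k (DiffRel.Ex (k := k) (t := t))
theorem Ey : genE k t * genY k t = genY k t * genE k t + genY k t := by
  simpa [genY, genE] using RingQuot.mkAlgHom_rel k (DiffRel.Ey (k := k) (t := t))
theorem ED : genE k t * genD k t = genD k t * genE k t + genD k t := by
  simpa [genD, genE] using RingQuot.mkAlgHom_rel k (DiffRel.ED (k := k) (t := t))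

/-- Lifting from the presentation. -/
theorem exists_lift {A : Type} [Ring A] [Algebra k A] (x y d e : A)
    (h1 : y * x = x * y) (h2 : d * x = x * d) (h3 : d * y = y * d + (y * y + t • (x * y)))
    (h4 : e * x = x * e + x) (h5 : e * y = y * e + y) (h6 : e * d = d * e + d) :
    ∃ f : DiffA k t →ₐ[k] A, f (genX k t) = x ∧ f (genY k t) = y ∧ f (genD k t) = d ∧
      f (genE k t) = e := by
  refine ⟨RingQuot.liftAlgHom k ⟨FreeAlgebra.lift k ![x, y, d, e], ?_⟩, ?_, ?_, ?_, ?_⟩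
  · intro a b h
    cases h <;> simp <;> assumption
  all_goals simp [genX, genY, genD, genE]

/-- Induction on generators. -/
theorem U_induction {C : DiffA k t → Prop} (hx : C (genX k t)) (hy : C (genY k t))
    (hd : C (genD k t)) (he : C (genE k t)) (hs : ∀ r : k, C (algebraMap k _ r))
    (ha : ∀ a b, C a → C b → C (a + b)) (hm : ∀ a b, C a → C b → C (a * b)) (u) : C u := by
  obtain ⟨a, rfl⟩ := RingQuot.mkAlgHom_surjective k (DiffRel k t) u
  induction a using FreeAlgebra.induction with
  | grade0 r => simpa using hs r
  | grade1 i =>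
    fin_cases i
    · exact hx
    · exact hy
    · exact hd
    · exact he
  | mul a b h1 h2 => rw [map_mul]; exact hm _ _ h1 h2
  | add a b h1 h2 => rw [map_add]; exact ha _ _ h1 h2

abbrev P (k : Type) [Field k] := MvPolynomial (Fin 4) k

noncomputable def dl : Derivation k (P k) (P k) :=
  mkDerivation k ![0, X 1 * X 1 + t • (X 0 * X 1), 0, 0]
noncomputable def ep : Derivation k (P k) (P k) :=
  mkDerivation k ![X 0, X 1, X 2, 0]

noncomputable def opD : Module.End k (P k) := (dl k t).toLinearMap + LinearMap.mulLeft k (X 2)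
noncomputable def opE : Module.End k (P k) := (ep k).toLinearMap + LinearMap.mulLeft k (X 3)

theorem opD_apply (p : P k) : opD k t p = dl k t p + X 2 * p := rfl
theorem opE_apply (p : P k) : opE k p = ep k p + X 3 * p := rfl

@[simp] theorem dl0 : dl k t (X 0) = 0 := by simp [dl]
@[simp] theorem dl1 : dl k t (X 1) = X 1 * X 1 + t • (X 0 * X 1) := by simp [dl]
@[simp] theorem dl2 : dl k t (X 2) = 0 := by simp [dl]
@[simp] theorem dl3 : dl k t (X 3) = 0 := by simp [dl]
@[simp] theorem ep0 : ep k (X 0) = X 0 := by simp [ep]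
@[simp] theorem ep1 : ep k (X 1) = X 1 := by simp [ep]
@[simp] theorem ep2 : ep k (X 2) = X 2 := by simp [ep]
@[simp] theorem ep3 : ep k (X 3) = 0 := by simp [ep]

theorem comm_der : ⁅ep k, dl k t⁆ = dl k t := by
  apply MvPolynomial.derivation_ext
  intro i
  fin_cases i <;> simp [Derivation.commutator_apply]
  simp only [smul_eq_C_mul]
  ring

theorem exists_rho : ∃ f : DiffA k t →ₐ[k] Module.End k (P k),
    f (genX k t) = LinearMap.mulLeft k (X 0) ∧ f (genY k t) = LinearMap.mulLeft k (X 1) ∧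
    f (genD k t) = opD k t ∧ f (genE k t) = opE k := by
  apply exists_lift
  · refine LinearMap.ext fun p => ?_
    simp; ring
  · refine LinearMap.ext fun p => ?_
    simp [opD_apply]; ring
  · refine LinearMap.ext fun p => ?_
    simp [opD_apply, smul_eq_C_mul]; ring
  · refine LinearMap.ext fun p => ?_
    simp [opE_apply]; ring
  · refine LinearMap.ext fun p => ?_
    simp [opE_apply]; ring
  · refine LinearMap.ext fun p => ?_
    have h := congrArg (fun d => d p) (comm_der k t)
    simp only [Derivation.commutator_apply] at h
    rw [sub_eq_iff_eq_add] at h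
    simp [opE_apply, opD_apply, h]; ring

noncomputable def rho : DiffA k t →ₐ[k] Module.End k (P k) := (exists_rho k t).choose

theorem rho_x (p) : rho k t (genX k t) p = X 0 * p := by
  rw [rho, (exists_rho k t).choose_spec.1]; rfl
theorem rho_y (p) : rho k t (genY k t) p = X 1 * p := by
  rw [rho, (exists_rho k t).choose_spec.2.1]; rfl
theorem rho_d (p) : rho k t (genD k t) p = opD k t p := by
  rw [rho, (exists_rho k t).choose_spec.2.2.1]
theorem rho_e (p) : rho k t (genE k t) p = opE k p := by
  rw [rho, (exists_rho k t).choose_spec.2.2.2]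

/-- The shift endomorphisms. -/
theorem exists_phi (a b c : k) : ∃ f : DiffA k t →ₐ[k] DiffA k t,
    f (genX k t) = genX k t ∧ f (genY k t) = genY k t ∧
    f (genD k t) = genD k t + a • genX k t + b • genY k t ∧
    f (genE k t) = genE k t + algebraMap k _ c := by
  apply exists_lift
  · exact yx k t
  · simp only [add_mul, mul_add, smul_mul_assoc, mul_smul_comm, Dx, yx]
  · simp only [add_mul, mul_add, smul_mul_assoc, mul_smul_comm, Dy, yx]; abel
  · simp only [add_mul, mul_add, Ex, Algebra.commutes]; abel
  · simp only [add_mul, mul_add, Ey, Algebra.commutes]; abel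
  · simp only [add_mul, mul_add, smul_mul_assoc, mul_smul_comm, ED, Ex, Ey, Algebra.commutes,
      smul_add]; abel

noncomputable def phi (a b c : k) : DiffA k t →ₐ[k] DiffA k t := (exists_phi k t a b c).choose

theorem phi_x (a b c) : phi k t a b c (genX k t) = genX k t :=
  (exists_phi k t a b c).choose_spec.1
theorem phi_y (a b c) : phi k t a b c (genY k t) = genY k t :=
  (exists_phi k t a b c).choose_spec.2.1
theorem phi_d (a b c) : phi k t a b c (genD k t) = genD k t + a • genX k t + b • genY k t :=
  (exists_phi k t a b c).choose_spec.2.2.1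
theorem phi_e (a b c) : phi k t a b c (genE k t) = genE k t + algebraMap k _ c :=
  (exists_phi k t a b c).choose_spec.2.2.2

theorem phi_phi (a b c a' b' c' : k) (u) :
    phi k t a b c (phi k t a' b' c' u) = phi k t (a + a') (b + b') (c + c') u := by
  induction u using U_induction with
  | hx => simp [phi_x]
  | hy => simp [phi_y]
  | hd => simp only [phi_d, map_add, map_smul, phi_x, phi_y, add_smul]; abel
  | he => simp only [phi_e, map_add, AlgHom.commutes]; abel
  | hs r => simp only [AlgHom.commutes]
  | ha a b h1 h2 => simp only [map_add, h1, h2]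
  | hm a b h1 h2 => simp only [map_mul, h1, h2]

theorem phi_zero (u) : phi k t 0 0 0 u = u := by
  induction u using U_induction with
  | hx => simp [phi_x]
  | hy => simp [phi_y]
  | hd => simp [phi_d]
  | he => simp [phi_e]
  | hs r => simp only [AlgHom.commutes]
  | ha a b h1 h2 => simp only [map_add, h1, h2]
  | hm a b h1 h2 => simp only [map_mul, h1, h2]

theorem normal_gen (a b c : k) (z : DiffA k t)
    (hx : genX k t * z = z * genX k t) (hy : genY k t * z = z * genY k t)
    (hd : genD k t * z = z * (genD k t + a • genX k t + b • genY k t))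
    (he : genE k t * z = z * (genE k t + algebraMap k _ c)) (u) :
    u * z = z * phi k t a b c u := by
  induction u using U_induction with
  | hx => simp [phi_x, hx]
  | hy => simp [phi_y, hy]
  | hd => simp [phi_d, hd]
  | he => simp [phi_e, he]
  | hs r => simp only [AlgHom.commutes, Algebra.commutes]
  | ha a b h1 h2 => simp only [map_add, add_mul, mul_add, h1, h2]
  | hm a b h1 h2 => rw [map_mul, mul_assoc, h2, ← mul_assoc, h1, mul_assoc]

theorem normal_x (u) : u * genX k t = genX k t * phi k t 0 0 1 u := by
  apply normal_gen
  · rfl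
  · exact yx k t
  · simp [Dx]
  · simp [Ex, mul_add]
theorem normal_y (u) : u * genY k t = genY k t * phi k t t 1 1 u := by
  apply normal_gen
  · exact (yx k t).symm
  · rfl
  · simp only [Dy, mul_add, mul_smul_comm, yx, one_smul]; abel
  · simp [Ey, mul_add]
theorem normal_z (u) : u * (genY k t + t • genX k t) =
    (genY k t + t • genX k t) * phi k t 0 1 1 u := by
  apply normal_gen
  · simp [mul_add, add_mul, yx]
  · simp [mul_add, add_mul, yx]
  · simp only [Dy, Dx, mul_add, add_mul, mul_smul_comm, smul_mul_assoc, one_smul, zero_smul,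
      add_zero]; abel
  · simp only [Ey, Ex, mul_add, add_mul, mul_smul_comm, smul_mul_assoc, map_one, mul_one,
      smul_add]; abel

/-- The shifts on polynomials. -/
noncomputable def th (a c : k) : P k →ₐ[k] P k := aeval ![X 0, X 1, X 2 + a • X 0, X 3 + C c]

theorem th_dl (a c : k) (p) : dl k t (th k a c p) = th k a c (dl k t p) := by
  induction p using MvPolynomial.induction_on with
  | C r => simp [← MvPolynomial.algebraMap_eq]
  | add p q hp hq => simp [hp, hq]
  | mul_X p i hp =>
    simp only [map_mul, Derivation.leibniz, map_add, smul_eq_mul, hp]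
    congr 2
    fin_cases i <;> simp [th, ← MvPolynomial.algebraMap_eq]

theorem th_ep (a c : k) (p) : ep k (th k a c p) = th k a c (ep k p) := by
  induction p using MvPolynomial.induction_on with
  | C r => simp [← MvPolynomial.algebraMap_eq]
  | add p q hp hq => simp [hp, hq]
  | mul_X p i hp =>
    simp only [map_mul, Derivation.leibniz, map_add, smul_eq_mul, hp]
    congr 2
    fin_cases i <;> simp [th, ← MvPolynomial.algebraMap_eq]

theorem rho_phi (a c : k) (u) : ∀ p, rho k t (phi k t a 0 c u) (th k a c p) =
    th k a c (rho k t u p) := by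
  induction u using U_induction with
  | hx => intro p; simp [phi_x, rho_x]; simp [th]
  | hy => intro p; simp [phi_y, rho_y]; simp [th]
  | hd =>
    intro p
    simp only [phi_d, zero_smul, add_zero, map_add, map_smul, LinearMap.add_apply,
      LinearMap.smul_apply, rho_d, rho_x, opD_apply, th_dl, map_mul]
    simp [th, add_mul, add_assoc]
  | he =>
    intro p
    simp only [phi_e, AlgHom.commutes, map_add, LinearMap.add_apply,
      rho_e, opE_apply, th_ep, map_mul]
    simp [th, add_mul, add_assoc, smul_eq_C_mul, Module.algebraMap_end_apply]
  | hs r => intro p; simp [Module.algebraMap_end_apply]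
  | ha a b h1 h2 => intro p; simp [h1, h2]
  | hm a b h1 h2 => intro p; simp [h1, h2]

noncomputable def nu (u : DiffA k t) : P k := rho k t u 1

theorem nu_phi (a c : k) (u) : nu k t (phi k t a 0 c u) = th k a c (nu k t u) := by
  have := rho_phi k t a c u 1
  simpa [nu] using this

noncomputable def sg : P k →ₗ[k] DiffA k t := (basisMonomials (Fin 4) k).constr k
  fun m => genX k t ^ m 0 * (genY k t ^ m 1 * (genD k t ^ m 2 * genE k t ^ m 3))

theorem sg_mon (m : Fin 4 →₀ ℕ) : sg k t (monomial m 1) =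
    genX k t ^ m 0 * (genY k t ^ m 1 * (genD k t ^ m 2 * genE k t ^ m 3)) := by
  have := (basisMonomials (Fin 4) k).constr_basis k
    (fun m => genX k t ^ m 0 * (genY k t ^ m 1 * (genD k t ^ m 2 * genE k t ^ m 3))) m
  simpa [sg] using this

theorem mon_eq (m : Fin 4 →₀ ℕ) : (monomial m 1 : P k) =
    X 0 ^ m 0 * (X 1 ^ m 1 * (X 2 ^ m 2 * X 3 ^ m 3)) := by
  rw [monomial_eq, Finsupp.prod_fintype _ _ (by simp)]
  simp [Fin.prod_univ_four, mul_assoc]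

theorem sg_pow (a b c d : ℕ) : sg k t (X 0 ^ a * (X 1 ^ b * (X 2 ^ c * X 3 ^ d))) =
    genX k t ^ a * (genY k t ^ b * (genD k t ^ c * genE k t ^ d)) := by
  have := sg_mon k t (Finsupp.equivFunOnFinite.symm ![a, b, c, d])
  rw [mon_eq] at this
  simpa using this

theorem mon_induction {C : P k → Prop} (hs : ∀ (r : k) p, C p → C (r • p))
    (ha : ∀ p q, C p → C q → C (p + q))
    (hm : ∀ a b c d : ℕ, C (X 0 ^ a * (X 1 ^ b * (X 2 ^ c * X 3 ^ d)))) (p : P k) : C p := by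
  induction p using MvPolynomial.induction_on' with
  | monomial m r =>
    have : (monomial m r : P k) = r • monomial m 1 := by simp [smul_monomial]
    rw [this, mon_eq]
    exact hs _ _ (hm _ _ _ _)
  | add p q hp hq => exact ha _ _ hp hq

theorem sg_x (p) : sg k t (X 0 * p) = genX k t * sg k t p := by
  induction p using mon_induction with
  | hs r p h => simp [h]
  | ha p q h1 h2 => simp [h1, h2, mul_add]
  | hm a b c d =>
    rw [← mul_assoc, ← pow_succ', sg_pow, sg_pow, pow_succ', mul_assoc]

theorem sg_y (p) : sg k t (X 1 * p) = genY k t * sg k t p := by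
  induction p using mon_induction with
  | hs r p h => simp [h]
  | ha p q h1 h2 => simp [h1, h2, mul_add]
  | hm a b c d =>
    rw [mul_left_comm, ← mul_assoc (X 1), ← pow_succ', sg_pow, sg_pow, pow_succ', mul_assoc,
      ← mul_assoc (genY k t) (genX k t ^ a), ((show Commute (genY k t) (genX k t) from
        yx k t).pow_right a).eq, mul_assoc]

theorem mon_induction2 {C : P k → Prop} (hs : ∀ (r : k) p, C p → C (r • p))
    (ha : ∀ p q, C p → C q → C (p + q)) (hx : ∀ p, C p → C (X 0 * p))
    (hy : ∀ p, C p → C (X 1 * p))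
    (hm : ∀ c d : ℕ, C (X 2 ^ c * X 3 ^ d)) (p : P k) : C p := by
  refine mon_induction k hs ha (fun a b c d => ?_) p
  induction a with
  | zero =>
    induction b with
    | zero => simpa using hm c d
    | succ b ih =>
      have := hy _ ih
      rw [pow_succ']; simpa [mul_assoc] using this
  | succ a ih => rw [pow_succ', mul_assoc]; exact hx _ ih

theorem sg_zw (c d : ℕ) : sg k t (X 2 ^ c * X 3 ^ d) = genD k t ^ c * genE k t ^ d := by
  simpa using sg_pow k t 0 0 c d

theorem sg_d (p) : sg k t (opD k t p) = genD k t * sg k t p := by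
  induction p using mon_induction2 with
  | hs r p h => simp [h]
  | ha p q h1 h2 => simp [h1, h2, mul_add]
  | hx p h =>
    have : opD k t (X 0 * p) = X 0 * opD k t p := by simp [opD_apply]; ring
    rw [this, sg_x, sg_x, h, ← mul_assoc, ← mul_assoc, Dx]
  | hy p h =>
    have : opD k t (X 1 * p) = X 1 * opD k t p + (X 1 * (X 1 * p) + t • (X 0 * (X 1 * p))) := by
      simp [opD_apply, smul_eq_C_mul]; ring
    rw [this]
    simp only [map_add, map_smul, sg_x, sg_y, h]
    rw [← mul_assoc (genD k t), Dy]
    simp only [add_mul, smul_mul_assoc, mul_assoc]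
  | hm c d =>
    have : opD k t (X 2 ^ c * X 3 ^ d) = X 2 ^ (c + 1) * X 3 ^ d := by
      simp [opD_apply, Derivation.leibniz_pow]; ring
    rw [this, sg_zw, sg_zw, pow_succ', mul_assoc]

theorem sg_e (p) : sg k t (opE k p) = genE k t * sg k t p := by
  induction p using mon_induction2 with
  | hs r p h => simp [h]
  | ha p q h1 h2 => simp [h1, h2, mul_add]
  | hx p h =>
    have : opE k (X 0 * p) = X 0 * opE k p + X 0 * p := by simp [opE_apply]; ring
    rw [this, map_add, sg_x, sg_x, h, ← mul_assoc, ← mul_assoc, Ex, add_mul]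
  | hy p h =>
    have : opE k (X 1 * p) = X 1 * opE k p + X 1 * p := by simp [opE_apply]; ring
    rw [this, map_add, sg_y, sg_y, h, ← mul_assoc, ← mul_assoc, Ey, add_mul]
  | hm c d =>
    induction c with
    | zero =>
      have : opE k (X 2 ^ 0 * X 3 ^ d) = X 2 ^ 0 * X 3 ^ (d + 1) := by
        simp [opE_apply, Derivation.leibniz_pow]; ring
      rw [this, sg_zw, sg_zw, pow_succ']; simp
    | succ c ih =>
      have h1 : opE k (X 2 ^ (c + 1) * X 3 ^ d) =
          opD k t (opE k (X 2 ^ c * X 3 ^ d)) + X 2 ^ (c + 1) * X 3 ^ d := by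
        have h0 : (X 2 ^ (c + 1) * X 3 ^ d : P k) = opD k t (X 2 ^ c * X 3 ^ d) := by
          simp [opD_apply, Derivation.leibniz_pow]; ring
        have h := congrArg (fun f => f (X 2 ^ c * X 3 ^ d)) (congrArg (rho k t) (ED k t))
        simp only [map_mul, map_add, Module.End.mul_apply, LinearMap.add_apply, rho_d, rho_e] at h
        rw [h0, h]
      rw [h1, map_add, sg_d, ih, sg_zw, sg_zw, pow_succ']
      have h2 : genE k t * (genD k t * genD k t ^ c * genE k t ^ d) =
          (genE k t * genD k t) * (genD k t ^ c * genE k t ^ d) := by simp only [mul_assoc]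
      rw [h2, ED]
      simp only [add_mul, mul_assoc]

theorem sg_rho (u) : ∀ p, sg k t (rho k t u p) = u * sg k t p := by
  induction u using U_induction with
  | hx => intro p; rw [rho_x, sg_x]
  | hy => intro p; rw [rho_y, sg_y]
  | hd => intro p; rw [rho_d, sg_d]
  | he => intro p; rw [rho_e, sg_e]
  | hs r => intro p; rw [AlgHom.commutes, Module.algebraMap_end_apply, map_smul, Algebra.smul_def]
  | ha a b h1 h2 => intro p; simp [h1, h2, add_mul]
  | hm a b h1 h2 => intro p; simp [h1, h2, mul_assoc]

theorem sg_one : sg k t 1 = 1 := by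
  simpa using sg_pow k t 0 0 0 0

theorem sg_nu (u) : sg k t (nu k t u) = u := by
  rw [nu, sg_rho, sg_one, mul_one]

theorem nu_mul (u v) : nu k t (u * v) = rho k t u (nu k t v) := by simp [nu]

theorem cancel (z : DiffA k t) (q : P k) (hq : q ≠ 0) (hz : ∀ p, rho k t z p = q * p)
    (u v) (h : z * u = z * v) : u = v := by
  have h1 := congrArg (nu k t) h
  rw [nu_mul, nu_mul, hz, hz] at h1
  rw [← sg_nu k t u, ← sg_nu k t v, mul_left_cancel₀ hq h1]

theorem yz_ne : (X 1 + t • X 0 : P k) ≠ 0 := by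
  intro h
  have := congrArg (eval ![0, 1, 0, 0]) h
  simp [smul_eq_C_mul] at this

theorem eval_th (a c : k) (v : Fin 4 → k) (p : P k) :
    eval v (th k a c p) = eval ![v 0, v 1, v 2 + a * v 0, v 3 + c] p := by
  induction p using MvPolynomial.induction_on with
  | C r => simp [← MvPolynomial.algebraMap_eq]
  | add p q hp hq => simp [hp, hq]
  | mul_X p i hp =>
    rw [map_mul, map_mul, map_mul, hp]
    congr 1
    fin_cases i <;> simp [th, smul_eq_C_mul]

theorem eval_nat (a c : k) (p : P k) (h : th k a c p = p) (v : Fin 4 → k) (n : ℕ) :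
    eval ![v 0, v 1, v 2 + n * (a * v 0), v 3 + n * c] p = eval v p := by
  induction n with
  | zero =>
    congr 2
    funext i
    fin_cases i <;> simp
  | succ n ih =>
    rw [← ih]
    conv_rhs => rw [← h, eval_th]
    congr 2
    funext i
    fin_cases i <;> simp <;> ring

theorem eval_all [CharZero k] (a c : k) (p : P k) (h : th k a c p = p) (v : Fin 4 → k) (s : k) :
    eval ![v 0, v 1, v 2 + s * (a * v 0), v 3 + s * c] p = eval v p := by
  let g : Polynomial k := aeval ![Polynomial.C (v 0), Polynomial.C (v 1),
    Polynomial.C (v 2) + Polynomial.X * Polynomial.C (a * v 0),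
    Polynomial.C (v 3) + Polynomial.X * Polynomial.C c] p
  have hg : ∀ s : k, g.eval s = eval ![v 0, v 1, v 2 + s * (a * v 0), v 3 + s * c] p := by
    intro s
    simp only [g]
    clear h g
    induction p using MvPolynomial.induction_on with
    | C r => simp
    | add p q hp hq => rw [map_add (aeval _), map_add (eval _), Polynomial.eval_add, hp, hq]
    | mul_X p i hp =>
      rw [map_mul (aeval _), map_mul (eval _), Polynomial.eval_mul, hp]
      congr 1
      fin_cases i <;> simp [mul_comm c s]
  have hc : g = Polynomial.C (eval v p) := by
    apply Polynomial.eq_of_infinite_eval_eq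
    refine (Set.infinite_range_of_injective (Nat.cast_injective (R := k))).mono ?_
    rintro _ ⟨n, rfl⟩
    simp [hg, eval_nat k a c p h v n]
  rw [← hg, hc, Polynomial.eval_C]

noncomputable def pr : P k →ₐ[k] P k := aeval ![X 0, X 1, 0, 0]

theorem eval_pr (v : Fin 4 → k) (p : P k) :
    eval v (pr k p) = eval ![v 0, v 1, 0, 0] p := by
  induction p using MvPolynomial.induction_on with
  | C r => simp [← MvPolynomial.algebraMap_eq]
  | add p q hp hq => simp [hp, hq]
  | mul_X p i hp =>
    rw [map_mul, map_mul, map_mul, hp]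
    congr 1
    fin_cases i <;> simp [pr]

theorem eq_pr [CharZero k] (ht : t ≠ 0) (p : P k) (h1 : th k t 0 p = p) (h2 : th k 0 1 p = p) :
    p = pr k p := by
  apply mul_left_cancel₀ (X_ne_zero (R := k) (0 : Fin 4))
  apply MvPolynomial.funext
  intro v
  rw [map_mul, map_mul, eval_X, eval_pr]
  by_cases hv : v 0 = 0
  · simp [hv]
  · congr 1
    rw [← eval_all k t 0 p h1 v (-(v 2) / (t * v 0)), ← eval_all k 0 1 p h2 _ (-(v 3))]
    congr 2
    funext i
    fin_cases i
    · simp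
    · simp
    · simp; field_simp; simp
    · simp

theorem sg_pr (p : P k) : sg k t (pr k p) ∈
    Algebra.adjoin k ({genX k t, genY k t} : Set (DiffA k t)) := by
  induction p using MvPolynomial.induction_on with
  | C r =>
    have : pr k (C r) = r • 1 := by
      rw [← MvPolynomial.algebraMap_eq, AlgHom.commutes, Algebra.algebraMap_eq_smul_one]
    rw [this, map_smul, sg_one]
    exact Subalgebra.smul_mem _ (one_mem _) _
  | add p q hp hq => rw [map_add, map_add]; exact add_mem hp hq
  | mul_X p i hp =>
    rw [mul_comm, map_mul]
    fin_cases i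
    · have : pr k (X 0) = X 0 := by simp [pr]
      simp only [Fin.zero_eta, this, sg_x]
      exact mul_mem (Algebra.subset_adjoin (by simp)) hp
    · have : pr k (X 1) = X 1 := by simp [pr]
      simp only [Fin.mk_one, this, sg_y]
      exact mul_mem (Algebra.subset_adjoin (by simp)) hp
    · simp [pr]
    · simp [pr]

end DiffAux

/-- An element of `U = Diff 𝒜` commutes with `x` and `y` if and only if it belongs to the
subalgebra `S` of `U` generated by `x` and `y`; i.e. the centralizer of `{x, y}` is `S`. -/
theorem centralizer_x_y_eq_adjoin
    [CharZero k] (ht : t ≠ 0) (u : DiffA k t) :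
    (u * genX k t = genX k t * u ∧ u * genY k t = genY k t * u) ↔
      u ∈ Algebra.adjoin k ({genX k t, genY k t} : Set (DiffA k t)) := by
  open DiffAux in
  constructor
  · rintro ⟨hx, hy⟩
    have ha : phi k t 0 0 1 u = u := by
      apply cancel k t (genX k t) _ (MvPolynomial.X_ne_zero 0) (rho_x k t)
      rw [← normal_x, hx]
    have hb : phi k t t 1 1 u = u := by
      apply cancel k t (genY k t) _ (MvPolynomial.X_ne_zero 1) (rho_y k t)
      rw [← normal_y, hy]
    have hc : phi k t 0 1 1 u = u := by
      apply cancel k t (genY k t + t • genX k t) _ (yz_ne k t)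
      · intro p
        simp [rho_x, rho_y, add_mul]
      · rw [← normal_z]
        simp [mul_add, add_mul, hx, hy]
    have hd : phi k t 0 (-1) (-1) u = u := by
      conv_lhs => rw [← hc]
      rw [phi_phi]
      simp [phi_zero]
    have he : phi k t t 0 0 u = u := by
      have := phi_phi k t 0 (-1) (-1) t 1 1 u
      rw [hb, hd] at this
      simpa using this.symm
    have h1 : th k t 0 (nu k t u) = nu k t u := by rw [← nu_phi, he]
    have h2 : th k 0 1 (nu k t u) = nu k t u := by rw [← nu_phi, ha]
    rw [← sg_nu k t u, eq_pr k t ht _ h1 h2]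
    exact sg_pr k t _
  · intro h
    induction h using Algebra.adjoin_induction with
    | mem a h =>
      rcases h with rfl | rfl
      · exact ⟨rfl, (yx k t).symm⟩
      · exact ⟨yx k t, rfl⟩
    | algebraMap r => exact ⟨Algebra.commutes _ _, Algebra.commutes _ _⟩
    | add a b _ _ h1 h2 => simp [add_mul, mul_add, h1, h2]
    | mul a b _ _ h1 h2 =>
      constructor
      · rw [mul_assoc, h2.1, ← mul_assoc, h1.1, mul_assoc]
      · rw [mul_assoc, h2.2, ← mul_assoc, h1.2, mul_assoc]
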